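/- Let δ > 0, γ ∈ (0, δ), let u be a symmetric function on S(−δ,δ), and set φ_γ(z) = u(z) − u(e^{iγ} z). Then: (1) if u is harmonic on the interior of S(δ), then φ_γ is harmonic on the interior of S(−δ, δ−γ); (2) if u is rotationally decreasing on S(δ), then φ_γ(z) ≥ 0 for all z ∈ S(−γ/2, δ−γ). -/

import Mathlib

/-- The closed sector `S(α,β) = {z ∈ ℂ \ {0} : arg z ∈ [α,β]}`. -/
def sector (α β : ℝ) : Set ℂ := {z : ℂ | z ≠ 0 ∧ α ≤ z.arg ∧ z.arg ≤ β}

/-- `u` is harmonic on `Ω`: in a ball around each point of `Ω` contained in `Ω`,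
`u` is the real part of a holomorphic function. -/
def HarmonicOnSet (u : ℂ → ℝ) (Ω : Set ℂ) : Prop :=
  ∀ z ∈ Ω, ∃ ε > 0, Metric.ball z ε ⊆ Ω ∧ ∃ g : ℂ → ℂ,
    DifferentiableOn ℂ g (Metric.ball z ε) ∧ ∀ w ∈ Metric.ball z ε, u w = (g w).re

/-- `u` is symmetric on `S`: `u(z) = u(conj z)` whenever both `z` and `conj z` lie in `S`. -/
def SymmetricOn (u : ℂ → ℝ) (S : Set ℂ) : Prop :=
  ∀ z ∈ S, (starRingEnd ℂ) z ∈ S → u z = u ((starRingEnd ℂ) z)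

/-- Polar form of a rotated point. -/
theorem exp_I_mul_mul_eq_polar (γ : ℝ) (z : ℂ) :
    Complex.exp (Complex.I * γ) * z =
      ((‖z‖ : ℝ) : ℂ) * Complex.exp (Complex.I * ((z.arg + γ : ℝ) : ℂ)) := by
  conv_lhs => rw [← Complex.norm_mul_exp_arg_mul_I z]
  rw [mul_left_comm, ← Complex.exp_add]
  push_cast
  ring_nf

theorem arg_exp_I_mul_mul {γ : ℝ} {z : ℂ} (hz : z ≠ 0)
    (h : z.arg + γ ∈ Set.Ioc (-Real.pi) Real.pi) :
    (Complex.exp (Complex.I * γ) * z).arg = z.arg + γ := by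
  rw [exp_I_mul_mul_eq_polar, mul_comm Complex.I, Complex.exp_mul_I]
  exact Complex.arg_mul_cos_add_sin_mul_I (norm_pos_iff.mpr hz) h

theorem exp_I_mul_mul_mem_sector {δ γ : ℝ} (hγ0 : 0 ≤ γ) {z : ℂ}
    (hz : z ∈ sector (-δ) (δ - γ)) :
    Complex.exp (Complex.I * γ) * z ∈ sector (-δ) δ := by
  obtain ⟨hz0, h1, h2⟩ := hz
  refine ⟨mul_ne_zero (Complex.exp_ne_zero _) hz0, ?_⟩
  rcases le_total Real.pi δ with h | h
  · constructor
    · linarith [Complex.neg_pi_lt_arg (Complex.exp (Complex.I * γ) * z)]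
    · linarith [Complex.arg_le_pi (Complex.exp (Complex.I * γ) * z)]
  · have := Complex.neg_pi_lt_arg z
    rw [arg_exp_I_mul_mul hz0 ⟨by linarith, by linarith⟩]
    constructor <;> linarith

theorem sector_mono_right {α β β' : ℝ} (h : β ≤ β') : sector α β ⊆ sector α β' :=
  fun _ hz => ⟨hz.1, hz.2.1, hz.2.2.trans h⟩

theorem HarmonicOnSet.mono {u : ℂ → ℝ} {s t : Set ℂ} (hu : HarmonicOnSet u t)
    (hs : IsOpen s) (hst : s ⊆ t) : HarmonicOnSet u s := by
  intro z hz
  obtain ⟨ε, hε, -, g, hg, hgu⟩ := hu z (hst hz)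
  obtain ⟨r, hr, hrs⟩ := Metric.isOpen_iff.mp hs z hz
  exact ⟨min ε r, lt_min hε hr, (Metric.ball_subset_ball (min_le_right _ _)).trans hrs, g,
    hg.mono (Metric.ball_subset_ball (min_le_left _ _)),
    fun w hw => hgu w (Metric.ball_subset_ball (min_le_left _ _) hw)⟩

theorem HarmonicOnSet.sub {u v : ℂ → ℝ} {s : Set ℂ} (hu : HarmonicOnSet u s)
    (hv : HarmonicOnSet v s) : HarmonicOnSet (fun z => u z - v z) s := by
  intro z hz
  obtain ⟨ε, hε, hs, g, hg, hgu⟩ := hu z hz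
  obtain ⟨r, hr, -, f, hf, hfv⟩ := hv z hz
  have hl : Metric.ball z (min ε r) ⊆ Metric.ball z ε :=
    Metric.ball_subset_ball (min_le_left _ _)
  have hr' : Metric.ball z (min ε r) ⊆ Metric.ball z r :=
    Metric.ball_subset_ball (min_le_right _ _)
  refine ⟨min ε r, lt_min hε hr, hl.trans hs, fun w => g w - f w,
    (hg.mono hl).sub (hf.mono hr'), fun w hw => ?_⟩
  simp only [Complex.sub_re, hgu w (hl hw), hfv w (hr' hw)]

theorem HarmonicOnSet.comp_mul_left {u : ℂ → ℝ} {s t : Set ℂ} {c : ℂ} (hc : ‖c‖ = 1)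
    (hu : HarmonicOnSet u t) (hs : IsOpen s) (hst : Set.MapsTo (c * ·) s t) :
    HarmonicOnSet (fun z => u (c * z)) s := by
  intro z hz
  obtain ⟨ε, hε, -, g, hg, hgu⟩ := hu (c * z) (hst hz)
  obtain ⟨r, hr, hrs⟩ := Metric.isOpen_iff.mp hs z hz
  have hmaps : Set.MapsTo (c * ·) (Metric.ball z (min ε r)) (Metric.ball (c * z) ε) := by
    intro w hw
    rw [Metric.mem_ball, dist_eq_norm] at hw ⊢
    rw [← mul_sub, norm_mul, hc, one_mul]
    exact hw.trans_le (min_le_left _ _)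
  exact ⟨min ε r, lt_min hε hr, (Metric.ball_subset_ball (min_le_right _ _)).trans hrs,
    fun w => g (c * w), hg.comp (differentiableOn_id.const_mul c) hmaps,
    fun w hw => hgu _ (hmaps hw)⟩

theorem mapsTo_exp_I_mul_interior_sector {δ γ : ℝ} (hγ0 : 0 ≤ γ) :
    Set.MapsTo (Complex.exp (Complex.I * γ) * ·) (interior (sector (-δ) (δ - γ)))
      (interior (sector (-δ) δ)) := by
  rw [Set.mapsTo_iff_image_subset]
  refine ((Homeomorph.mulLeft₀ _ (Complex.exp_ne_zero (Complex.I * γ))).image_interior _).trans_subset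
    (interior_mono ?_)
  rintro _ ⟨z, hz, rfl⟩
  exact exp_I_mul_mul_mem_sector hγ0 hz

/-- **Observation 2.1**. For `δ > 0`, `γ ∈ (0,δ)` and a symmetric function `u` on
`S(−δ,δ)`, with `φ_γ(z) = u(z) − u(e^{iγ} z)`:
(1) if `u` is harmonic on the interior of `S(δ)`, then `φ_γ` is harmonic on the interior
of `S(−δ, δ−γ)`;
(2) if `u` is rotationally decreasing on `S(δ)`, then `φ_γ ≥ 0` on `S(−γ/2, δ−γ)`. -/
theorem phi_gamma_harmonic_and_positive
    (δ γ : ℝ) (hδ : 0 < δ) (hγ0 : 0 < γ) (hγδ : γ < δ) (u : ℂ → ℝ)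
    (hsym : SymmetricOn u (sector (-δ) δ)) :
    (HarmonicOnSet u (interior (sector (-δ) δ)) →
      HarmonicOnSet (fun z => u z - u (Complex.exp (Complex.I * γ) * z))
        (interior (sector (-δ) (δ - γ)))) ∧
    ((∀ ρ : ℝ, 0 < ρ → ∀ θ₁ θ₂ : ℝ, 0 ≤ θ₁ → θ₁ ≤ θ₂ → θ₂ ≤ δ →
        u ((ρ : ℂ) * Complex.exp (Complex.I * θ₂)) ≤
          u ((ρ : ℂ) * Complex.exp (Complex.I * θ₁))) →
      ∀ z ∈ sector (-(γ / 2)) (δ - γ),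
        0 ≤ u z - u (Complex.exp (Complex.I * γ) * z)) := by
  constructor
  · intro hu
    have hc : ‖Complex.exp (Complex.I * γ)‖ = 1 := by
      rw [mul_comm, Complex.norm_exp_ofReal_mul_I]
    exact (hu.mono isOpen_interior
      (interior_mono (sector_mono_right (by linarith)))).sub
      (hu.comp_mul_left hc isOpen_interior (mapsTo_exp_I_mul_interior_sector hγ0.le))
  · rintro hdec z ⟨hz0, h1, h2⟩
    have hρ : 0 < ‖z‖ := norm_pos_iff.mpr hz0
    rw [sub_nonneg, exp_I_mul_mul_eq_polar]
    rcases le_or_gt 0 z.arg with h | h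
    · have := hdec ‖z‖ hρ z.arg (z.arg + γ) h (by linarith) (by linarith)
      rwa [mul_comm Complex.I (z.arg : ℂ), Complex.norm_mul_exp_arg_mul_I] at this
    · have harg : ((starRingEnd ℂ) z).arg = -z.arg := by
        rw [Complex.arg_conj, if_neg (by linarith [Real.pi_pos])]
      have hconj : ((‖z‖ : ℝ) : ℂ) * Complex.exp (Complex.I * ((-z.arg : ℝ) : ℂ)) =
          (starRingEnd ℂ) z := by
        rw [← harg, ← Complex.norm_conj, mul_comm Complex.I, Complex.norm_mul_exp_arg_mul_I]
      rw [hsym z ⟨hz0, by linarith, by linarith⟩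
        ⟨by simpa using hz0, by rw [harg]; linarith, by rw [harg]; linarith⟩, ← hconj]
      exact hdec ‖z‖ hρ (-z.arg) (z.arg + γ) (by linarith) (by linarith) (by linarith)
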